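/- Let λ ∈ ℝ, u ∈ ℝ³ with u ≠ 0, and ζ ∈ ℝ³. Define the grazing-collision weight G_ε(u,ζ) = |u|^λ ∫_{S²} b_ε((u·σ)/|u|)(e^{−(i/2)|u| ζ·σ} e^{(i/2) ζ·u} − 1) dσ, where σ ∈ S² and the angle θ ∈ [0,π] is given by cos θ = (u·σ)/|u|. Then as ε → 0⁺, G_ε(u,ζ) converges to the Fourier weight of the Fokker-Planck-Landau operator: lim_{ε → 0⁺} G_ε(u,ζ) = 4 |u|^λ ( i (ζ·u) − ¼ |u|² |ζ^⊥|² ), where ζ^⊥ = ζ − ((ζ·u)/|u|²) u. -/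

import Mathlib

open MeasureTheory Metric Filter
open scoped RealInnerProductSpace

section helpers
open scoped ENNReal Pointwise

abbrev E3 := EuclideanSpace ℝ (Fin 3)

/-- cartesian coordinates -/
lemma lintegral_cart (b : OrthonormalBasis (Fin 3) ℝ E3) (g : E3 → ℝ≥0∞) :
    ∫⁻ x, g x = ∫⁻ q : ℝ × (ℝ × ℝ), g (q.1 • b 0 + q.2.1 • b 1 + q.2.2 • b 2) := by
  have h1 := b.measurePreserving_repr_symm
  have h2 := PiLp.volume_preserving_toLp (Fin 3)
  have h3 := (volume_preserving_piFinSuccAbove (fun _ : Fin 3 => ℝ) 0).symm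
  have h4 := (MeasurePreserving.id (volume : Measure ℝ)).prod
    (volume_preserving_finTwoArrow ℝ).symm
  rw [← h1.lintegral_comp_emb b.repr.symm.toHomeomorph.measurableEmbedding,
    ← h2.lintegral_comp_emb (MeasurableEquiv.toLp 2 (Fin 3 → ℝ)).measurableEmbedding,
    ← h3.lintegral_comp_emb (MeasurableEquiv.measurableEmbedding _)]
  have h5 := h4.lintegral_comp_emb ((MeasurableEquiv.refl ℝ).prodCongr
    (MeasurableEquiv.finTwoArrow (α := ℝ)).symm).measurableEmbedding
    (fun a => g (b.repr.symm (WithLp.toLp 2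
      ((MeasurableEquiv.piFinSuccAbove (fun x : Fin 3 ↦ ℝ) 0).symm a))))
  refine h5.symm.trans ?_
  refine lintegral_congr fun q => ?_
  congr 1
  rw [← b.sum_repr_symm]
  simp [Fin.sum_univ_three, MeasurableEquiv.piFinSuccAbove, Fin.insertNthEquiv, MeasurableEquiv.finTwoArrow]

/-- point of the sphere -/
noncomputable def sph (b : OrthonormalBasis (Fin 3) ℝ E3) (p : ℝ × ℝ) : E3 :=
  Real.cos p.1 • b 0 + (Real.sin p.1 * Real.cos p.2) • b 1 + (Real.sin p.1 * Real.sin p.2) • b 2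

lemma lintegral_polar (f : ℝ × ℝ → ℝ≥0∞) (hf : Measurable f) :
    ∫⁻ p, f p = ∫⁻ r in Set.Ioi (0:ℝ), ∫⁻ t in Set.Ioo (-Real.pi) Real.pi,
      ENNReal.ofReal r * f (r * Real.cos t, r * Real.sin t) := by
  rw [← lintegral_comp_polarCoord_symm]
  simp only [polarCoord_target, polarCoord_symm_apply, smul_eq_mul]
  rw [Measure.volume_eq_prod, ← Measure.prod_restrict, lintegral_prod]
  apply Measurable.aemeasurable
  fun_prop

lemma lintegral_spherical (b : OrthonormalBasis (Fin 3) ℝ E3) (g : E3 → ℝ≥0∞)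
    (hg : Measurable g) :
    ∫⁻ x, g x = ∫⁻ f in Set.Ioo (-Real.pi) Real.pi, ∫⁻ r in Set.Ioi (0:ℝ),
      ∫⁻ t in Set.Ioo 0 Real.pi,
        ENNReal.ofReal (r ^ 2 * Real.sin t) * g (r • sph b (t, f)) := by
  rw [lintegral_cart b, Measure.volume_eq_prod, lintegral_prod _ (by fun_prop)]
  have e1 : ∀ z : ℝ, ∫⁻ y : ℝ × ℝ, g (z • b 0 + y.1 • b 1 + y.2 • b 2) =
      ∫⁻ f in Set.Ioo (-Real.pi) Real.pi, ∫⁻ r in Set.Ioi (0:ℝ), ENNReal.ofReal r *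
        g (z • b 0 + (r * Real.cos f) • b 1 + (r * Real.sin f) • b 2) := by
    intro z
    rw [lintegral_polar _ (by fun_prop), lintegral_lintegral_swap]
    apply Measurable.aemeasurable
    fun_prop
  simp only [e1]
  rw [lintegral_lintegral_swap (by
    apply Measurable.aemeasurable
    apply Measurable.lintegral_prod_right'
      (f := fun p : (ℝ × ℝ) × ℝ => ENNReal.ofReal p.2 *
        g (p.1.1 • b 0 + (p.2 * Real.cos p.1.2) • b 1 + (p.2 * Real.sin p.1.2) • b 2))
    fun_prop)]
  refine lintegral_congr fun f => ?_
  have e2 : ∀ z : ℝ, ∫⁻ r in Set.Ioi (0:ℝ), ENNReal.ofReal r *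
        g (z • b 0 + (r * Real.cos f) • b 1 + (r * Real.sin f) • b 2) =
      ∫⁻ r : ℝ, ENNReal.ofReal r *
        g (z • b 0 + (r * Real.cos f) • b 1 + (r * Real.sin f) • b 2) := by
    intro z
    rw [← lintegral_indicator measurableSet_Ioi]
    refine lintegral_congr fun r => ?_
    by_cases h : 0 < r
    · simp [h]
    · simp [h, ENNReal.ofReal_of_nonpos (not_lt.1 h)]
  simp only [e2]
  have e3 := lintegral_prod (μ := (volume : Measure ℝ)) (ν := (volume : Measure ℝ))
    (fun q : ℝ × ℝ => ENNReal.ofReal q.2 *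
        g (q.1 • b 0 + (q.2 * Real.cos f) • b 1 + (q.2 * Real.sin f) • b 2))
    (by apply Measurable.aemeasurable; fun_prop)
  rw [← e3, ← Measure.volume_eq_prod, lintegral_polar _ (by fun_prop)]
  refine setLIntegral_congr_fun measurableSet_Ioi fun r hr => ?_
  rw [← lintegral_indicator measurableSet_Ioo, ← lintegral_indicator measurableSet_Ioo]
  refine lintegral_congr fun t => ?_
  have hr : 0 < r := hr
  by_cases h : t ∈ Set.Ioo 0 Real.pi
  · have h' : t ∈ Set.Ioo (-Real.pi) Real.pi := ⟨by linarith [h.1, Real.pi_pos], h.2⟩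
    rw [Set.indicator_of_mem h, Set.indicator_of_mem h', ← mul_assoc,
      ← ENNReal.ofReal_mul hr.le]
    congr 2
    · ring
    · simp [sph, smul_add, smul_smul, mul_assoc]
  · rw [Set.indicator_of_notMem h]
    by_cases h' : t ∈ Set.Ioo (-Real.pi) Real.pi
    · rw [Set.indicator_of_mem h']
      have : Real.sin t ≤ 0 := Real.sin_nonpos_of_nonpos_of_neg_pi_le
        (by by_contra hc; exact h ⟨not_le.1 hc, h'.2⟩) h'.1.le
      simp [ENNReal.ofReal_of_nonpos (mul_nonpos_of_nonneg_of_nonpos hr.le this)]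
    · rw [Set.indicator_of_notMem h']

lemma norm_sph (b : OrthonormalBasis (Fin 3) ℝ E3) (p : ℝ × ℝ) : ‖sph b p‖ = 1 := by
  have : ‖sph b p‖ ^ 2 = 1 := by
    rw [← b.sum_sq_inner_right]
    simp [Fin.sum_univ_three, sph, inner_add_right, inner_smul_right, b.inner_eq_ite]
    nlinarith [Real.sin_sq_add_cos_sq p.1, Real.sin_sq_add_cos_sq p.2]
  nlinarith [norm_nonneg (sph b p)]

noncomputable def sphS (b : OrthonormalBasis (Fin 3) ℝ E3) (p : ℝ × ℝ) : sphere (0 : E3) 1 :=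
  ⟨sph b p, by simp [norm_sph]⟩

lemma continuous_sphS (b : OrthonormalBasis (Fin 3) ℝ E3) : Continuous (sphS b) := by
  unfold sphS sph
  fun_prop

lemma toSphere_eq (b : OrthonormalBasis (Fin 3) ℝ E3) :
    (volume : Measure E3).toSphere = Measure.map (sphS b)
      (((volume.restrict (Set.Ioo 0 Real.pi)).prod
        (volume.restrict (Set.Ioo (-Real.pi) Real.pi))).withDensity
          (fun p => ENNReal.ofReal (Real.sin p.1))) := by
  have hm := (continuous_sphS b).measurable
  ext s hs
  rw [Measure.toSphere_apply' _ hs, Measure.map_apply hm hs, withDensity_apply _ (hm hs)]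
  have hball : MeasurableSet (Set.Ioo (0:ℝ) 1 • ((↑) '' s : Set E3)) := by
    have he : (Set.Ioo (0:ℝ) 1 • ((↑) '' s : Set E3)) =
        (↑) '' (homeomorphUnitSphereProd E3 ⁻¹' s ×ˢ Set.Iio ⟨1, Set.mem_Ioi.2 one_pos⟩) := by
      rw [← Set.image2_smul, Set.image2_image_right, ← Homeomorph.image_symm, Set.image_image,
        ← Set.image_subtype_val_Ioi_Iio (a := (0:ℝ)) ⟨1, Set.mem_Ioi.2 one_pos⟩,
        Set.image2_image_left, Set.image2_swap, ← Set.image_prod]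
      rfl
    rw [he]
    refine (MeasurableEmbedding.subtype_coe
      (measurableSet_singleton _).compl).measurableSet_image.2 ?_
    exact (homeomorphUnitSphereProd E3).measurable (hs.prod measurableSet_Iio)
  rw [← lintegral_indicator_one hball, lintegral_spherical b _ (measurable_one.indicator hball),
    ← lintegral_indicator (hm hs), lintegral_prod_symm _ (by
      apply Measurable.aemeasurable
      apply Measurable.indicator _ (hm hs)
      fun_prop), ← lintegral_const_mul' _ _ (by simp)]
  refine lintegral_congr fun f => ?_
  have key : ∀ r ∈ Set.Ioi (0:ℝ), ∀ t, 
      (Set.Ioo (0:ℝ) 1 • ((↑) '' s : Set E3)).indicator (1 : E3 → ℝ≥0∞) (r • sph b (t, f))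
        = (Set.Iio (1:ℝ)).indicator 1 r * (sphS b ⁻¹' s).indicator 1 (t, f) := by
    intro r hr t
    have hr : 0 < r := hr
    have : r • sph b (t, f) ∈ (Set.Ioo (0:ℝ) 1 • ((↑) '' s : Set E3)) ↔
        r < 1 ∧ sphS b (t,f) ∈ s := by
      constructor
      · rintro ⟨r', hr', _, ⟨x, hx, rfl⟩, h⟩
        have h : r' • (x : E3) = r • sph b (t, f) := h
        have hn := congrArg norm h
        rw [norm_smul, norm_smul, norm_sph, norm_eq_of_mem_sphere, Real.norm_of_nonneg hr'.1.le,
          Real.norm_of_nonneg hr.le, mul_one, mul_one] at hn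
        subst hn
        refine ⟨hr'.2, ?_⟩
        have : x = sphS b (t, f) := Subtype.ext (smul_right_injective _ hr.ne' h)
        rwa [← this]
      · rintro ⟨h1, h2⟩
        exact ⟨r, ⟨hr, h1⟩, _, ⟨_, h2, rfl⟩, rfl⟩
    by_cases h1 : r < 1 <;> by_cases h2 : sphS b (t,f) ∈ s <;>
      simp [Set.indicator, this, h1, h2]
  have : ∀ r ∈ Set.Ioi (0:ℝ), ∫⁻ t in Set.Ioo 0 Real.pi,
      ENNReal.ofReal (r ^ 2 * Real.sin t) *
       (Set.Ioo (0:ℝ) 1 • ((↑) '' s : Set E3)).indicator (1 : E3 → ℝ≥0∞) (r • sph b (t, f)) =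
      (Set.Iio (1:ℝ)).indicator (fun r => ENNReal.ofReal (r^2)) r * ∫⁻ t in Set.Ioo 0 Real.pi,
       (sphS b ⁻¹' s).indicator (fun p => ENNReal.ofReal (Real.sin p.1)) (t, f) := by
    intro r hr
    rw [← lintegral_const_mul' _ _ (by
      by_cases h1 : r < 1 <;> simp [h1, Set.indicator])]
    refine lintegral_congr fun t => ?_
    rw [key r hr, ENNReal.ofReal_mul (by positivity)]
    by_cases h1 : r < 1 <;> by_cases h2 : sphS b (t,f) ∈ s <;>
      simp [Set.indicator, h1, h2]
  rw [setLIntegral_congr_fun measurableSet_Ioi this, lintegral_mul_const _ (by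
      apply Measurable.indicator _ measurableSet_Iio
      fun_prop), ← mul_assoc]
  have h13 : ∫⁻ r in Set.Ioi (0:ℝ), (Set.Iio (1:ℝ)).indicator (fun r => ENNReal.ofReal (r^2)) r
      = ENNReal.ofReal (1/3) := by
    rw [lintegral_indicator measurableSet_Iio, Measure.restrict_restrict measurableSet_Iio,
      Set.inter_comm, Set.Ioi_inter_Iio, restrict_Ioo_eq_restrict_Ioc,
      ← ofReal_integral_eq_lintegral_ofReal, ← intervalIntegral.integral_of_le zero_le_one]
    · norm_num
    · exact (continuous_pow 2).integrableOn_Ioc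
    · exact Eventually.of_forall fun x => by positivity
  rw [h13]
  have : ((Module.finrank ℝ E3 : ℕ) : ℝ≥0∞) * ENNReal.ofReal (1/3) = 1 := by
    rw [finrank_euclideanSpace, ← ENNReal.ofReal_natCast, ← ENNReal.ofReal_mul (by positivity)]
    norm_num
  rw [this, one_mul]

lemma exp_I_bound (x : ℝ) :
    ‖Complex.exp (Complex.I * x) - 1 - (Complex.I * x - (x:ℂ) ^ 2 / 2)‖
      ≤ |x| ^ 3 * Real.exp |x| := by
  have h := Complex.norm_exp_sub_sum_le_norm_mul_exp (Complex.I * x) 3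
  have e : ‖Complex.I * (x:ℂ)‖ = |x| := by simp
  rw [e] at h
  convert h using 2
  simp [Finset.sum_range_succ, mul_pow, Nat.factorial]
  ring

lemma cos_rem_bound {x : ℝ} (hx : 0 ≤ x) :
    |1 - Real.cos x - x ^ 2 / 2| ≤ x ^ 3 * Real.exp x := by
  have h := exp_I_bound x
  rw [abs_of_nonneg hx] at h
  refine le_trans ?_ h
  have := Complex.abs_re_le_norm
    (Complex.exp (Complex.I * x) - 1 - (Complex.I * x - (x:ℂ) ^ 2 / 2))
  refine le_trans (le_of_eq ?_) this
  have e1 : (Complex.exp (Complex.I * x)).re = Real.cos x := by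
    rw [mul_comm, Complex.exp_ofReal_mul_I_re]
  have e2 : ((x:ℂ) ^ 2 / 2).re = x ^ 2 / 2 := by
    rw [show ((x:ℂ) ^ 2 / 2) = ((x ^ 2 / 2 : ℝ) : ℂ) by push_cast; rfl, Complex.ofReal_re]
  rw [Complex.sub_re, Complex.sub_re, Complex.sub_re, e1, e2, ← abs_neg]
  simp
  congr 1
  ring

/-- phase -/
noncomputable def phX (a d1 d2 t f : ℝ) : ℝ :=
  a * (1 - Real.cos t) - Real.sin t * (d1 * Real.cos f + d2 * Real.sin f)

lemma continuous_phX (a d1 d2 : ℝ) : Continuous (fun p : ℝ × ℝ => phX a d1 d2 p.1 p.2) := by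
  unfold phX; fun_prop

lemma continuous_phX' (a d1 d2 t : ℝ) : Continuous (fun f : ℝ => phX a d1 d2 t f) := by
  unfold phX; fun_prop

noncomputable def phH (a d1 d2 t : ℝ) : ℂ :=
  ∫ f in (-Real.pi)..Real.pi, (Complex.exp (Complex.I * phX a d1 d2 t f) - 1)

lemma continuous_phH (a d1 d2 : ℝ) : Continuous (phH a d1 d2) := by
  unfold phH
  apply intervalIntegral.continuous_parametric_intervalIntegral_of_continuous'
  have := continuous_phX a d1 d2
  unfold Function.uncurry
  fun_prop

lemma int_phX (a d1 d2 t : ℝ) : ∫ f in (-Real.pi)..Real.pi, phX a d1 d2 t f =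
    2 * Real.pi * a * (1 - Real.cos t) := by
  rw [intervalIntegral.integral_eq_sub_of_hasDerivAt
    (f := fun f => a * (1 - Real.cos t) * f
      - Real.sin t * (d1 * Real.sin f - d2 * Real.cos f))]
  · simp; ring
  · intro x _
    have h := ((hasDerivAt_id x).const_mul (a * (1 - Real.cos t))).sub
      ((((Real.hasDerivAt_sin x).const_mul d1).sub
        ((Real.hasDerivAt_cos x).const_mul d2)).const_mul (Real.sin t))
    refine h.congr_deriv ?_
    simp [phX]
  · exact (continuous_phX' a d1 d2 t).intervalIntegrable _ _

lemma int_phX_sq (a d1 d2 t : ℝ) : ∫ f in (-Real.pi)..Real.pi, phX a d1 d2 t f ^ 2 =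
    2 * Real.pi * (a * (1 - Real.cos t)) ^ 2
      + Real.pi * (d1 ^ 2 + d2 ^ 2) * Real.sin t ^ 2 := by
  rw [intervalIntegral.integral_eq_sub_of_hasDerivAt
    (f := fun f => (a * (1 - Real.cos t)) ^ 2 * f
      - 2 * (a * (1 - Real.cos t)) * Real.sin t * (d1 * Real.sin f - d2 * Real.cos f)
      + Real.sin t ^ 2 * (d1 ^ 2 / 2 * (f + Real.sin f * Real.cos f)
        + d2 ^ 2 / 2 * (f - Real.sin f * Real.cos f) + d1 * d2 * (Real.sin f * Real.sin f)))]
  · simp; ring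
  · intro x _
    have hs := Real.hasDerivAt_sin x
    have hc := Real.hasDerivAt_cos x
    have hi := hasDerivAt_id' x
    have h := ((hi.const_mul ((a * (1 - Real.cos t)) ^ 2)).sub
      (((hs.const_mul d1).sub (hc.const_mul d2)).const_mul
        (2 * (a * (1 - Real.cos t)) * Real.sin t))).add
      (((((hi.add (hs.mul hc)).const_mul (d1 ^ 2 / 2)).add
        ((hi.sub (hs.mul hc)).const_mul (d2 ^ 2 / 2))).add
          ((hs.mul hs).const_mul (d1 * d2))).const_mul (Real.sin t ^ 2))
    refine h.congr_deriv ?_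
    have := Real.sin_sq_add_cos_sq x
    have e : Real.sin x ^ 2 = 1 - Real.cos x ^ 2 := by linarith
    simp only [phX]
    ring_nf
    rw [e]
    ring
  · exact ((continuous_phX' a d1 d2 t).pow 2).intervalIntegrable _ _

lemma phX_bound (a d1 d2 t f : ℝ) (h0 : 0 < t) (h1 : t < Real.pi) :
    |phX a d1 d2 t f| ≤ (2 * |a| + |d1| + |d2|) * t := by
  have hc := Real.one_sub_sq_div_two_le_cos (x := t)
  have hc1 := Real.cos_le_one t
  have hpi := Real.pi_le_four
  have h2 : |1 - Real.cos t| ≤ 2 * t := by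
    rw [abs_of_nonneg (by linarith)]; nlinarith
  have h3 : |Real.sin t| ≤ t := by
    have := Real.abs_sin_le_abs (x := t)
    rwa [abs_of_pos h0] at this
  have h4 : |d1 * Real.cos f + d2 * Real.sin f| ≤ |d1| + |d2| := by
    refine (abs_add_le _ _).trans ?_
    rw [abs_mul, abs_mul]
    nlinarith [Real.abs_cos_le_one f, Real.abs_sin_le_one f, abs_nonneg d1, abs_nonneg d2]
  unfold phX
  refine (abs_sub _ _).trans ?_
  rw [abs_mul, abs_mul]
  have h5 := mul_le_mul_of_nonneg_left h2 (abs_nonneg a)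
  have h6 := mul_le_mul h3 h4 (abs_nonneg _) h0.le
  nlinarith

lemma phH_bound (a d1 d2 : ℝ) : ∃ C : ℝ, ∀ t ∈ Set.Ioo 0 Real.pi,
    ‖phH a d1 d2 t - (Real.pi * Complex.I * a - Real.pi / 2 * (d1 ^ 2 + d2 ^ 2)) * t ^ 2‖
      ≤ C * t ^ 3 := by
  set K := 2 * |a| + |d1| + |d2| with hK
  have hK0 : 0 ≤ K := by positivity
  have hpi := Real.pi_pos
  refine ⟨K ^ 3 * Real.exp (K * Real.pi) * (2 * Real.pi) + (2 * Real.pi * |a| * Real.exp Real.pi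
    + Real.pi * a ^ 2 + Real.pi / 2 * (d1 ^ 2 + d2 ^ 2) * (4 * Real.exp (2 * Real.pi))), ?_⟩
  rintro t ⟨h0, h1⟩
  have cX := continuous_phX' a d1 d2 t
  have hi1 : IntervalIntegrable (fun f => Complex.exp (Complex.I * phX a d1 d2 t f) - 1) volume
    (-Real.pi) Real.pi := Continuous.intervalIntegrable (by fun_prop) _ _
  have hi2 : IntervalIntegrable (fun f => Complex.I * (phX a d1 d2 t f : ℂ)) volume
    (-Real.pi) Real.pi := Continuous.intervalIntegrable (by fun_prop) _ _
  have hi3 : IntervalIntegrable (fun f => (phX a d1 d2 t f : ℂ) ^ 2 / 2) volume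
    (-Real.pi) Real.pi := Continuous.intervalIntegrable (by fun_prop) _ _
  have eQ : phH a d1 d2 t - (Complex.I * (2 * Real.pi * a * (1 - Real.cos t) : ℝ)
      - ((2 * Real.pi * (a * (1 - Real.cos t)) ^ 2
      + Real.pi * (d1 ^ 2 + d2 ^ 2) * Real.sin t ^ 2 : ℝ) : ℂ) / 2) =
      ∫ f in (-Real.pi)..Real.pi, (Complex.exp (Complex.I * phX a d1 d2 t f) - 1 -
        (Complex.I * phX a d1 d2 t f - (phX a d1 d2 t f : ℂ) ^ 2 / 2)) := by
    rw [intervalIntegral.integral_sub hi1 (hi2.sub hi3), intervalIntegral.integral_sub hi2 hi3,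
      intervalIntegral.integral_const_mul, intervalIntegral.integral_div,
      intervalIntegral.integral_ofReal, int_phX]
    simp_rw [← Complex.ofReal_pow]
    rw [intervalIntegral.integral_ofReal, int_phX_sq]
    rfl
  have b1 : ‖∫ f in (-Real.pi)..Real.pi, (Complex.exp (Complex.I * phX a d1 d2 t f) - 1 -
        (Complex.I * phX a d1 d2 t f - (phX a d1 d2 t f : ℂ) ^ 2 / 2))‖ ≤
        K ^ 3 * Real.exp (K * Real.pi) * (2 * Real.pi) * t ^ 3 := by
    refine (intervalIntegral.norm_integral_le_of_norm_le_const
      (C := K ^ 3 * Real.exp (K * Real.pi) * t ^ 3) ?_).trans (le_of_eq ?_)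
    · intro f _
      refine (exp_I_bound _).trans ?_
      have hb := phX_bound a d1 d2 t f h0 h1
      rw [← hK] at hb
      have hb2 : |phX a d1 d2 t f| ≤ K * Real.pi :=
        hb.trans (mul_le_mul_of_nonneg_left h1.le hK0)
      calc |phX a d1 d2 t f| ^ 3 * Real.exp |phX a d1 d2 t f|
          ≤ (K * t) ^ 3 * Real.exp (K * Real.pi) := by gcongr
        _ = _ := by ring
    · rw [abs_of_pos (by linarith)]; ring
  have r1 := cos_rem_bound h0.le
  have r2 := cos_rem_bound (x := 2 * t) (by linarith)
  have r1' : |1 - Real.cos t - t ^ 2 / 2| ≤ Real.exp Real.pi * t ^ 3 := by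
    refine r1.trans ?_
    rw [mul_comm]
    gcongr
  have r2' : |Real.sin t ^ 2 - t ^ 2| ≤ 4 * Real.exp (2 * Real.pi) * t ^ 3 := by
    have e : Real.sin t ^ 2 - t ^ 2 = (1 - Real.cos (2 * t) - (2 * t) ^ 2 / 2) / 2 := by
      rw [Real.cos_two_mul, Real.cos_sq']; ring
    rw [e, abs_div, abs_two]
    have : (2 * t) ^ 3 * Real.exp (2 * t) ≤ (2 * t) ^ 3 * Real.exp (2 * Real.pi) := by gcongr
    linarith
  have r3 : (1 - Real.cos t) ^ 2 ≤ t ^ 3 := by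
    have hc := Real.one_sub_sq_div_two_le_cos (x := t)
    have hc1 := Real.cos_le_one t
    have hpi := Real.pi_le_four
    have : (1 - Real.cos t) ^ 2 ≤ (t ^ 2 / 2) ^ 2 := by
      gcongr
      · linarith
    have h3 : 0 < t ^ 3 := by positivity
    nlinarith
  have eD : phH a d1 d2 t -
      (Real.pi * Complex.I * a - Real.pi / 2 * (d1 ^ 2 + d2 ^ 2)) * t ^ 2 =
      (phH a d1 d2 t - (Complex.I * (2 * Real.pi * a * (1 - Real.cos t) : ℝ)
      - ((2 * Real.pi * (a * (1 - Real.cos t)) ^ 2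
      + Real.pi * (d1 ^ 2 + d2 ^ 2) * Real.sin t ^ 2 : ℝ) : ℂ) / 2)) +
      (Complex.I * (2 * Real.pi * a * (1 - Real.cos t - t ^ 2 / 2) : ℝ)
       + (-(Real.pi * a ^ 2 * (1 - Real.cos t) ^ 2) : ℝ)
       + (-(Real.pi / 2 * (d1 ^ 2 + d2 ^ 2) * (Real.sin t ^ 2 - t ^ 2)) : ℝ)) := by
    push_cast
    ring
  rw [eD, eQ, add_mul]
  refine (norm_add_le _ _).trans (add_le_add b1 ?_)
  refine (norm_add₃_le).trans ?_
  rw [norm_mul, Complex.norm_I, one_mul, Complex.norm_real, Complex.norm_real, Complex.norm_real,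
    norm_neg, norm_neg, Real.norm_eq_abs, Real.norm_eq_abs, Real.norm_eq_abs, add_mul, add_mul]
  refine add_le_add (add_le_add ?_ ?_) ?_
  · rw [abs_mul, abs_mul, abs_of_pos (by positivity : (0:ℝ) < 2 * Real.pi),
      mul_assoc _ (Real.exp _)]
    exact mul_le_mul_of_nonneg_left r1' (by positivity)
  · rw [abs_mul, abs_of_nonneg (by positivity : (0:ℝ) ≤ Real.pi * a ^ 2),
      abs_of_nonneg (sq_nonneg _)]
    exact mul_le_mul_of_nonneg_left r3 (by positivity)
  · rw [abs_mul, abs_of_nonneg (by positivity : (0:ℝ) ≤ Real.pi / 2 * (d1 ^ 2 + d2 ^ 2)),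
      mul_assoc _ (4 * Real.exp _)]
    exact mul_le_mul_of_nonneg_left r2' (by positivity)

lemma kernel_limit (H : ℝ → ℂ) (hH : Continuous H) (L : ℂ) (C : ℝ)
    (hC : ∀ t ∈ Set.Ioo 0 Real.pi, ‖H t - L * t ^ 2‖ ≤ C * t ^ 3) :
    Tendsto (fun ε : ℝ => ∫ t in Set.Ioo 0 Real.pi,
      ((if ε ≤ t then 8 * ε / (Real.pi * t ^ 4) else 0 : ℝ) : ℂ) * H t)
      (nhdsWithin 0 (Set.Ioi 0)) (nhds (8 / Real.pi * L)) := by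
  have hpi := Real.pi_pos
  have hev : ∀ᶠ ε in nhdsWithin (0:ℝ) (Set.Ioi 0), ε ∈ Set.Ioo 0 Real.pi :=
    Ioo_mem_nhdsGT hpi
  have hform : ∀ ε ∈ Set.Ioo 0 Real.pi, ∫ t in Set.Ioo 0 Real.pi,
      ((if ε ≤ t then 8 * ε / (Real.pi * t ^ 4) else 0 : ℝ) : ℂ) * H t =
      (8 / Real.pi : ℝ) * ((1 - ε / Real.pi : ℝ) * L +
        ε * ∫ t in ε..Real.pi, ((t:ℂ) ^ 4)⁻¹ * (H t - L * t ^ 2)) := by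
    rintro ε ⟨h0, h1⟩
    have hne : ∀ t ∈ Set.uIcc ε Real.pi, (t:ℂ) ≠ 0 := by
      intro t ht
      rw [Set.uIcc_of_le h1.le] at ht
      exact_mod_cast (h0.trans_le ht.1).ne'
    have e1 : ∫ t in Set.Ioo 0 Real.pi,
      ((if ε ≤ t then 8 * ε / (Real.pi * t ^ 4) else 0 : ℝ) : ℂ) * H t =
      ∫ t in ε..Real.pi, (8 / Real.pi * ε : ℂ) * (((t:ℂ) ^ 4)⁻¹ * H t) := by
      rw [intervalIntegral.integral_of_le h1.le, ← integral_Icc_eq_integral_Ioc,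
        integral_Icc_eq_integral_Ico, ← integral_indicator measurableSet_Ioo,
        ← integral_indicator measurableSet_Ico]
      congr 1
      ext t
      by_cases ht : t ∈ Set.Ico ε Real.pi
      · rw [Set.indicator_of_mem ht, Set.indicator_of_mem
          (show t ∈ Set.Ioo 0 Real.pi from ⟨h0.trans_le ht.1, ht.2⟩), if_pos ht.1]
        push_cast
        field_simp
      · rw [Set.indicator_of_notMem ht]
        by_cases ht' : t ∈ Set.Ioo 0 Real.pi
        · rw [Set.indicator_of_mem ht', if_neg (fun h => ht ⟨h, ht'.2⟩)]
          simp
        · rw [Set.indicator_of_notMem ht']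
    have c4 : ContinuousOn (fun t : ℝ => ((t:ℂ) ^ 4)⁻¹) (Set.uIcc ε Real.pi) :=
      ContinuousOn.inv₀ (by fun_prop) (fun t ht => pow_ne_zero _ (hne t ht))
    have e2 : ∫ t in ε..Real.pi, ((t:ℂ) ^ 4)⁻¹ * H t =
        (∫ t in ε..Real.pi, ((t:ℂ) ^ 4)⁻¹ * (H t - L * t ^ 2)) +
         ∫ t in ε..Real.pi, (((t ^ 2)⁻¹ : ℝ) : ℂ) * L := by
      rw [← intervalIntegral.integral_add]
      · refine intervalIntegral.integral_congr fun t ht => ?_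
        have := hne t ht
        push_cast
        field_simp
        ring
      · exact (c4.mul (by fun_prop)).intervalIntegrable
      · refine ContinuousOn.intervalIntegrable ?_
        push_cast
        exact (ContinuousOn.inv₀ (by fun_prop) (fun t ht => pow_ne_zero _ (hne t ht))).mul
          (by fun_prop)
    have e3 : ∫ t in ε..Real.pi, (t ^ 2)⁻¹ = 1 / ε - 1 / Real.pi := by
      rw [intervalIntegral.integral_eq_sub_of_hasDerivAt (f := fun t => - t⁻¹)]
      · field_simp; ring
      · intro t ht
        have : t ≠ 0 := by exact_mod_cast hne t ht
        exact (hasDerivAt_inv this).neg.congr_deriv (by simp)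
      · refine ContinuousOn.intervalIntegrable ?_
        exact (ContinuousOn.inv₀ (by fun_prop)
          (fun t ht => pow_ne_zero _ (by exact_mod_cast hne t ht)))
    rw [e1, intervalIntegral.integral_const_mul, e2, intervalIntegral.integral_mul_const,
      intervalIntegral.integral_ofReal, e3]
    generalize (∫ t in ε..Real.pi, ((t:ℂ) ^ 4)⁻¹ * (H t - L * t ^ 2)) = J
    have : (ε:ℂ) ≠ 0 := by exact_mod_cast h0.ne'
    have : (Real.pi:ℂ) ≠ 0 := by exact_mod_cast hpi.ne'
    push_cast
    field_simp
    ring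
  have hrem : Tendsto (fun ε : ℝ => (ε:ℂ) *
      ∫ t in ε..Real.pi, ((t:ℂ) ^ 4)⁻¹ * (H t - L * t ^ 2))
      (nhdsWithin 0 (Set.Ioi 0)) (nhds 0) := by
    have hlog : Tendsto (fun ε : ℝ => C * (ε * Real.log Real.pi - ε * Real.log ε))
        (nhdsWithin 0 (Set.Ioi 0)) (nhds 0) := by
      have t1 : Tendsto (fun ε : ℝ => ε) (nhdsWithin 0 (Set.Ioi 0)) (nhds 0) :=
        tendsto_id.mono_left nhdsWithin_le_nhds
      have := ((t1.mul_const (Real.log Real.pi)).sub (Real.continuous_mul_log.tendsto 0 |>.mono_left nhdsWithin_le_nhds)).const_mul C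
      simpa using this
    refine squeeze_zero_norm' ?_ hlog
    filter_upwards [hev] with ε hε
    obtain ⟨h0, h1⟩ := hε
    have hb : ‖∫ t in ε..Real.pi, ((t:ℂ) ^ 4)⁻¹ * (H t - L * t ^ 2)‖ ≤
        ∫ t in ε..Real.pi, C * t⁻¹ := by
      refine intervalIntegral.norm_integral_le_of_norm_le h1.le ?_ ?_
      · have : ∀ᵐ t : ℝ, t ≠ Real.pi := by simp [ae_iff]
        filter_upwards [this] with t htp ht
        have ht0 : 0 < t := h0.trans ht.1
        have := hC t ⟨ht0, lt_of_le_of_ne ht.2 htp⟩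
        rw [norm_mul, norm_inv, norm_pow, Complex.norm_real, Real.norm_of_nonneg ht0.le]
        calc (t ^ 4)⁻¹ * ‖H t - L * t ^ 2‖ ≤ (t ^ 4)⁻¹ * (C * t ^ 3) := by gcongr
          _ = C * t⁻¹ := by field_simp
      · refine ContinuousOn.intervalIntegrable ?_
        refine ContinuousOn.mul (by fun_prop) (ContinuousOn.inv₀ (by fun_prop) ?_)
        intro t ht
        rw [Set.uIcc_of_le h1.le] at ht
        exact (h0.trans_le ht.1).ne'
    rw [intervalIntegral.integral_const_mul, integral_inv_of_pos h0 hpi,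
      Real.log_div hpi.ne' h0.ne'] at hb
    rw [norm_mul, Complex.norm_real, Real.norm_of_nonneg h0.le]
    refine (mul_le_mul_of_nonneg_left hb h0.le).trans (le_of_eq ?_)
    ring
  have hmain : Tendsto (fun ε : ℝ => ((8 / Real.pi : ℝ) : ℂ) * ((1 - ε / Real.pi : ℝ) * L +
        ε * ∫ t in ε..Real.pi, ((t:ℂ) ^ 4)⁻¹ * (H t - L * t ^ 2)))
      (nhdsWithin 0 (Set.Ioi 0)) (nhds (((8 / Real.pi : ℝ) : ℂ) * ((1 - 0 / Real.pi : ℝ) * L + 0))) := by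
    refine Tendsto.const_mul _ (Tendsto.add (Tendsto.mul_const _ ?_) hrem)
    have : Continuous (fun ε : ℝ => ((1 - ε / Real.pi : ℝ) : ℂ)) := by fun_prop
    exact (this.tendsto 0).mono_left nhdsWithin_le_nhds
  have hL : ((8 / Real.pi : ℝ) : ℂ) * ((1 - 0 / Real.pi : ℝ) * L + 0) = 8 / Real.pi * L := by
    simp
  rw [hL] at hmain
  refine hmain.congr' ?_
  filter_upwards [hev] with ε hε
  exact (hform ε hε).symm

lemma integral_sphere (b : OrthonormalBasis (Fin 3) ℝ E3) (K : sphere (0 : E3) 1 → ℂ)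
    (hK : Measurable K) :
    ∫ σ, K σ ∂(volume : Measure E3).toSphere =
      ∫ p in Set.Ioo 0 Real.pi ×ˢ Set.Ioo (-Real.pi) Real.pi,
        (Real.sin p.1 : ℂ) * K (sphS b p) ∂(volume.prod volume : Measure (ℝ × ℝ)) := by
  rw [toSphere_eq b, integral_map (continuous_sphS b).aemeasurable hK.aestronglyMeasurable,
    integral_withDensity_eq_integral_toReal_smul (by fun_prop)
      (Eventually.of_forall fun _ => ENNReal.ofReal_lt_top), Measure.prod_restrict]
  refine setIntegral_congr_fun (measurableSet_Ioo.prod measurableSet_Ioo) fun p hp => ?_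
  rw [ENNReal.toReal_ofReal (Real.sin_nonneg_of_nonneg_of_le_pi hp.1.1.le hp.1.2.le),
    Complex.real_smul]

lemma exists_basis (u : E3) (hu : u ≠ 0) :
    ∃ b : OrthonormalBasis (Fin 3) ℝ E3, u = ‖u‖ • b 0 := by
  have hn : ‖u‖ ≠ 0 := norm_ne_zero_iff.2 hu
  obtain ⟨b, hb⟩ := Orthonormal.exists_orthonormalBasis_extension_of_card_eq (𝕜 := ℝ) (E := E3)
    (ι := Fin 3) (by simp) (v := fun _ => ‖u‖⁻¹ • u) (s := {0}) (by
      constructor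
      · intro i
        simp [norm_smul, hn]
      · intro i j hij
        exact absurd (Subsingleton.elim i j) hij)
  refine ⟨b, ?_⟩
  rw [hb 0 rfl, smul_smul, mul_inv_cancel₀ hn, one_smul]
end helpers

/-- In the grazing collisions limit, the spectral weights of the
Boltzmann operator converge to the Fourier weight of the Fokker-Planck-Landau
operator. -/
theorem grazing_limit_of_spectral_weights
    (lam : ℝ) (u ζ : EuclideanSpace ℝ (Fin 3)) (hu : u ≠ 0)
    (beps : ℝ → ℝ → ℝ)
    (hbeps : ∀ ε c : ℝ, beps ε c =
      if ε ≤ Real.arccos c then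
        8 * ε / (Real.pi * (Real.arccos c) ^ 4 * Real.sin (Real.arccos c))
      else 0)
    (Geps : ℝ → ℂ)
    (hGeps : ∀ ε : ℝ, Geps ε =
      (‖u‖ ^ lam : ℝ) * ∫ σ : sphere (0 : EuclideanSpace ℝ (Fin 3)) 1,
        (beps ε (⟪u, (σ : EuclideanSpace ℝ (Fin 3))⟫ / ‖u‖) : ℂ) *
          (Complex.exp (-(Complex.I / 2) * ‖u‖ * ⟪ζ, (σ : EuclideanSpace ℝ (Fin 3))⟫) *
              Complex.exp ((Complex.I / 2) * ⟪ζ, u⟫) - 1)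
        ∂(volume : Measure (EuclideanSpace ℝ (Fin 3))).toSphere)
    (ζperp : EuclideanSpace ℝ (Fin 3))
    (hζperp : ζperp = ζ - (⟪ζ, u⟫ / ‖u‖ ^ 2) • u) :
    Filter.Tendsto Geps (nhdsWithin 0 (Set.Ioi 0))
      (nhds ((4 * ‖u‖ ^ lam : ℝ) *
        (Complex.I * (⟪ζ, u⟫ : ℝ) - ((1/4 : ℝ) * ‖u‖ ^ 2 * ‖ζperp‖ ^ 2 : ℝ)))) := by
  obtain ⟨b, hb⟩ := exists_basis u hu
  have hn : 0 < ‖u‖ := norm_pos_iff.2 hu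
  set n := ‖u‖ with hn_def
  have hpi := Real.pi_pos
  obtain ⟨a, ha⟩ : ∃ a, a = n * ⟪ζ, b 0⟫ / 2 := ⟨_, rfl⟩
  obtain ⟨d1, hd1⟩ : ∃ a, a = n * ⟪ζ, b 1⟫ / 2 := ⟨_, rfl⟩
  obtain ⟨d2, hd2⟩ : ∃ a, a = n * ⟪ζ, b 2⟫ / 2 := ⟨_, rfl⟩
  have hzu : ⟪ζ, u⟫ = n * ⟪ζ, b 0⟫ := by rw [hb, inner_smul_right]
  have hperp : ‖ζperp‖ ^ 2 = ⟪ζ, b 1⟫ ^ 2 + ⟪ζ, b 2⟫ ^ 2 := by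
    have e : ζperp = ζ - ⟪ζ, b 0⟫ • b 0 := by
      rw [hζperp, hzu]
      rw [hb, smul_smul]
      congr 2
      field_simp
    rw [e, ← b.sum_sq_inner_left]
    simp [Fin.sum_univ_three, inner_sub_left, inner_smul_left, b.inner_eq_ite]
  have hcos : ∀ p : ℝ × ℝ, ⟪u, sph b p⟫ / n = Real.cos p.1 := by
    intro p
    rw [hb, sph]
    simp [inner_smul_left, inner_add_right, inner_smul_right, b.inner_eq_ite]
    field_simp
  have hphase : ∀ p : ℝ × ℝ, Complex.exp (-(Complex.I / 2) * n * ⟪ζ, sph b p⟫) *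
      Complex.exp ((Complex.I / 2) * ⟪ζ, u⟫) = Complex.exp (Complex.I * phX a d1 d2 p.1 p.2) := by
    intro p
    rw [← Complex.exp_add]
    congr 1
    rw [hzu, sph, inner_add_right, inner_add_right, inner_smul_right, inner_smul_right,
      inner_smul_right, phX, ha, hd1, hd2]
    push_cast
    ring
  have hform : ∀ ε ∈ Set.Ioi (0:ℝ), Geps ε = (n ^ lam : ℝ) * ∫ t in Set.Ioo 0 Real.pi,
      ((if ε ≤ t then 8 * ε / (Real.pi * t ^ 4) else 0 : ℝ) : ℂ) * phH a d1 d2 t := by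
    intro ε hε
    have hε : 0 < ε := hε
    have hbm : Measurable (beps ε) := by
      have : beps ε = fun c => if ε ≤ Real.arccos c then
        8 * ε / (Real.pi * (Real.arccos c) ^ 4 * Real.sin (Real.arccos c)) else 0 :=
        funext (hbeps ε)
      rw [this]
      refine Measurable.ite (measurableSet_le measurable_const Real.measurable_arccos) ?_
        measurable_const
      have := Real.measurable_arccos
      fun_prop
    rw [hGeps, integral_sphere b _ (by fun_prop)]
    congr 1
    have e1 : ∫ p in Set.Ioo 0 Real.pi ×ˢ Set.Ioo (-Real.pi) Real.pi,
        (Real.sin p.1 : ℂ) * ((beps ε (⟪u, (sphS b p : EuclideanSpace ℝ (Fin 3))⟫ / n) : ℂ) *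
          (Complex.exp (-(Complex.I / 2) * n * ⟪ζ, (sphS b p : EuclideanSpace ℝ (Fin 3))⟫) *
              Complex.exp ((Complex.I / 2) * ⟪ζ, u⟫) - 1))
          ∂(volume.prod volume : Measure (ℝ × ℝ)) =
        ∫ p in Set.Ioo 0 Real.pi ×ˢ Set.Ioo (-Real.pi) Real.pi,
          ((if ε ≤ p.1 then 8 * ε / (Real.pi * p.1 ^ 4) else 0 : ℝ) : ℂ) *
            (Complex.exp (Complex.I * phX a d1 d2 p.1 p.2) - 1)
          ∂(volume.prod volume : Measure (ℝ × ℝ)) := by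
      refine setIntegral_congr_fun (measurableSet_Ioo.prod measurableSet_Ioo) fun p hp => ?_
      have hs : (Real.sin p.1 : ℂ) ≠ 0 := by
        exact_mod_cast (Real.sin_pos_of_pos_of_lt_pi hp.1.1 hp.1.2).ne'
      have ht : (p.1 : ℂ) ≠ 0 := by exact_mod_cast hp.1.1.ne'
      simp only [sphS]
      rw [hphase, hcos, hbeps, Real.arccos_cos hp.1.1.le hp.1.2.le, ← mul_assoc]
      congr 1
      split_ifs
      · push_cast
        push_cast at hs
        field_simp
      · simp
    rw [e1, setIntegral_prod]
    · refine setIntegral_congr_fun measurableSet_Ioo fun t _ => ?_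
      simp only
      rw [integral_const_mul, phH, intervalIntegral.integral_of_le (by linarith),
        integral_Ioc_eq_integral_Ioo]
    · have cX := continuous_phX a d1 d2
      refine Measure.integrableOn_of_bounded (M := 8 * ε / (Real.pi * ε ^ 4) * 2) ?_ ?_ ?_
      · rw [Measure.prod_prod]
        simp [ENNReal.mul_eq_top]
      · apply Measurable.aestronglyMeasurable
        refine Measurable.mul ?_ (by fun_prop)
        refine Complex.measurable_ofReal.comp ?_
        refine Measurable.ite (measurableSet_le measurable_const measurable_fst) ?_
          measurable_const
        fun_prop
      · refine Eventually.of_forall fun p => ?_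
        rw [norm_mul]
        refine mul_le_mul ?_ ?_ (norm_nonneg _) (by positivity)
        · rw [Complex.norm_real]
          split_ifs with h
          · have : 0 < p.1 := hε.trans_le h
            rw [Real.norm_of_nonneg (by positivity)]
            gcongr
          · simp; positivity
        · refine (norm_sub_le _ _).trans ?_
          rw [mul_comm, Complex.norm_exp_ofReal_mul_I]
          norm_num
  obtain ⟨C, hC⟩ := phH_bound a d1 d2
  have hlim := (kernel_limit (phH a d1 d2) (continuous_phH a d1 d2) _ C hC).const_mul
    ((n ^ lam : ℝ) : ℂ)
  have hval : ((4 * n ^ lam : ℝ) : ℂ) *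
        (Complex.I * (⟪ζ, u⟫ : ℝ) - ((1/4 : ℝ) * n ^ 2 * ‖ζperp‖ ^ 2 : ℝ)) =
      ((n ^ lam : ℝ) : ℂ) * (8 / Real.pi *
        (Real.pi * Complex.I * a - Real.pi / 2 * (d1 ^ 2 + d2 ^ 2))) := by
    have : (Real.pi : ℂ) ≠ 0 := by exact_mod_cast hpi.ne'
    rw [hperp, hzu, ha, hd1, hd2]
    generalize (n ^ lam : ℝ) = N
    push_cast
    field_simp
    ring
  rw [hval]
  refine hlim.congr' ?_
  filter_upwards [self_mem_nhdsWithin] with ε hε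
  exact (hform ε hε).symm
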